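/- Let S be a positive semifield, X a left S-module with structure map a, and 𝒰 a set of subsets of X. Then conv(⋃_{U ∈ 𝒰} U) = ⋃ { α_a(Φ) | Φ : 𝒫X → S finitely supported, Σ_B Φ(B) = 1, supp Φ ⊆ { conv(U) | U ∈ 𝒰 } }. -/

import Mathlib

universe u

/-- The structure map of the free `S`-module (semimodule) monad on a left `S`-module `M`:
`a(φ) = Σ_{x ∈ supp φ} φ(x) • x`. -/
noncomputable def structMap (S : Type*) (M : Type*) [Semiring S] [AddCommMonoid M]
    [Module S M] (φ : M →₀ S) : M :=
  φ.sum fun x s => s • x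

/-- The convex closure of a subset `A` of a left `S`-module:
`conv(A) = { a(φ) | φ finitely supported, supp φ ⊆ A, Σ_x φ(x) = 1 }`. -/
def convClos (S : Type*) {M : Type*} [Semiring S] [AddCommMonoid M] [Module S M]
    (A : Set M) : Set M :=
  { m | ∃ φ : M →₀ S, ↑φ.support ⊆ A ∧ (φ.sum fun _ s => s) = 1 ∧ structMap S M φ = m }

/-- A subset of a left `S`-module is convex if it equals its convex closure. -/
def IsConvex (S : Type*) {M : Type*} [Semiring S] [AddCommMonoid M] [Module S M]
    (A : Set M) : Prop :=
  convClos S A = A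

/-- `c(Φ)`: the set of finitely supported functions of the form
`x ↦ Σ_{A ∈ supp Φ, u(A) = x} Φ(A)` for choice functions `u` with `u(A) ∈ A` on `supp Φ`. -/
noncomputable def choiceSet {S : Type*} {X : Type*} [Semiring S] (Φ : Set X →₀ S) :
    Set (X →₀ S) :=
  { φ | ∃ u : Set X → X, (∀ A ∈ Φ.support, u A ∈ A) ∧ φ = Finsupp.mapDomain u Φ }

/-- The canonical weak distributive law `δ_X(Φ) = conv(c(Φ))`,
the convex closure being taken in the module `X →₀ S`. -/
noncomputable def deltaLaw (S : Type*) {X : Type*} [Semiring S] (Φ : Set X →₀ S) :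
    Set (X →₀ S) :=
  convClos S (choiceSet Φ)

/-- `α_a(Φ) = { a(φ) | φ ∈ c(Φ) }`, where `a` is the structure map of the module `M`. -/
noncomputable def alphaMap (S : Type*) {M : Type*} [Semiring S] [AddCommMonoid M]
    [Module S M] (Φ : Set M →₀ S) : Set M :=
  structMap S M '' choiceSet Φ

/-- The Eilenberg–Moore style description of `δ_X(Φ)` via witnesses
`ψ` finitely supported on `{(A, x) | x ∈ A}` such that
`Φ(A) = Σ_{x ∈ A} ψ(A,x)` for all `A` and `φ(x) = Σ_{A ∋ x} ψ(A,x)` for all `x`. -/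
noncomputable def deltaEM (S : Type*) {X : Type*} [Semiring S] (Φ : Set X →₀ S) :
    Set (X →₀ S) :=
  { φ | ∃ ψ : (Set X × X) →₀ S,
      (∀ p ∈ ψ.support, p.2 ∈ p.1) ∧
      Finsupp.mapDomain Prod.fst ψ = Φ ∧
      Finsupp.mapDomain Prod.snd ψ = φ }

/-- The multiplication of the convex-powerset-of-semimodule monad:
`μ(𝒜) = ⋃_{Ω ∈ 𝒜} α(Ω)`. -/
noncomputable def muC (S : Type*) {M : Type*} [Semiring S] [AddCommMonoid M] [Module S M]
    (𝒜 : Set (Set M →₀ S)) : Set M :=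
  ⋃ Ω ∈ 𝒜, alphaMap S Ω

/-- The Kleisli extension `g♯` of `g : Y → C Z`:
`g♯(𝒜) = ⋃_{φ ∈ 𝒜} { Σ_{y ∈ supp φ} φ(y) • ψ_y | ψ_y ∈ g(y) }`. -/
noncomputable def kleisliExt {S : Type*} {Y Z : Type*} [Semiring S]
    (g : Y → Set (Z →₀ S)) (𝒜 : Set (Y →₀ S)) : Set (Z →₀ S) :=
  ⋃ φ ∈ 𝒜, { χ | ∃ ψ : Y → (Z →₀ S), (∀ y ∈ φ.support, ψ y ∈ g y) ∧
      χ = ∑ y ∈ φ.support, φ y • ψ y }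

theorem convClos_mono (S : Type*) {M : Type*} [Semiring S] [AddCommMonoid M] [Module S M]
    {A B : Set M} (h : A ⊆ B) : convClos S A ⊆ convClos S B := by
  rintro m ⟨φ, hφ, h1, hm⟩
  exact ⟨φ, hφ.trans h, h1, hm⟩

theorem subset_convClos (S : Type*) {M : Type*} [Semiring S] [AddCommMonoid M] [Module S M]
    (A : Set M) : A ⊆ convClos S A := by
  classical
  intro x hx
  refine ⟨Finsupp.single x 1, fun y hy => ?_, by simp, by simp [structMap]⟩
  have hy' : y = x := by
    by_contra hne
    simp [Ne.symm hne] at hy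
  exact hy' ▸ hx

/-- The convex closure is closed under finite convex combinations. -/
theorem sum_smul_mem_convClos {S M ι : Type*} [Semiring S] [AddCommMonoid M] [Module S M]
    {A : Set M} (s : Finset ι) (w : ι → S) (y : ι → M) (hw : ∑ i ∈ s, w i = 1)
    (hy : ∀ i ∈ s, y i ∈ convClos S A) : ∑ i ∈ s, w i • y i ∈ convClos S A := by
  classical
  have hex : ∀ i, ∃ φ : M →₀ S, i ∈ s →
      ↑φ.support ⊆ A ∧ (φ.sum fun _ s => s) = 1 ∧ structMap S M φ = y i := by
    intro i
    by_cases hi : i ∈ s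
    · obtain ⟨φ, hφ⟩ := hy i hi
      exact ⟨φ, fun _ => hφ⟩
    · exact ⟨0, fun h => absurd h hi⟩
  choose φ hφ using hex
  have hstruct : ∀ ψ : M →₀ S, structMap S M ψ = Finsupp.linearCombination S id ψ :=
    fun ψ => by simp [structMap, Finsupp.linearCombination_apply]
  have hmass : ∀ ψ : M →₀ S,
      (ψ.sum fun _ s => s) = Finsupp.linearCombination S (fun _ : M => (1 : S)) ψ :=
    fun ψ => by simp [Finsupp.linearCombination_apply]
  refine ⟨∑ i ∈ s, w i • φ i, fun x hx => ?_, ?_, ?_⟩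
  · by_contra hxA
    refine (Finsupp.mem_support_iff.mp hx) ?_
    rw [Finsupp.finsetSum_apply]
    refine Finset.sum_eq_zero fun i hi => ?_
    have h0 : φ i x = 0 := Finsupp.notMem_support_iff.mp fun h => hxA ((hφ i hi).1 h)
    simp [h0]
  · rw [hmass, map_sum]
    refine Eq.trans ?_ hw
    refine Finset.sum_congr rfl fun i hi => ?_
    rw [map_smul, ← hmass, (hφ i hi).2.1, smul_eq_mul, mul_one]
  · rw [hstruct, map_sum]
    refine Finset.sum_congr rfl fun i hi => ?_
    rw [map_smul, ← hstruct, (hφ i hi).2.2]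

theorem structMap_mapDomain {S M ι : Type*} [Semiring S] [AddCommMonoid M] [Module S M]
    (u : ι → M) (Φ : ι →₀ S) :
    structMap S M (Finsupp.mapDomain u Φ) = Φ.sum fun i s => s • u i :=
  Finsupp.sum_mapDomain_index (fun _ => zero_smul S _) fun _ _ _ => add_smul _ _ _

theorem eq_zero_of_sum_eq_zero {S ι : Type*} [AddCommMonoid S]
    (hpos : ∀ a b : S, a + b = 0 → a = 0 ∧ b = 0) {s : Finset ι} {f : ι → S}
    (h : ∑ i ∈ s, f i = 0) {i : ι} (hi : i ∈ s) : f i = 0 := by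
  classical
  rw [← Finset.add_sum_erase s f hi] at h
  exact (hpos _ _ h).1

/-- `conv(⋃ 𝒰) = ⋃ { α_a(Φ) | Σ_B Φ(B) = 1, supp Φ ⊆ { conv(U) | U ∈ 𝒰 } }`. -/
theorem convClos_sUnion_eq_iUnion_alphaMap {S : Type*} [DivisionSemiring S]
    (hpos : ∀ a b : S, a + b = 0 → a = 0 ∧ b = 0)
    {X : Type u} [AddCommMonoid X] [Module S X] (𝒰 : Set (Set X)) :
    convClos S (⋃₀ 𝒰) =
      ⋃ Φ ∈ { Φ : Set X →₀ S | (Φ.sum fun _ s => s) = 1 ∧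
                ↑Φ.support ⊆ convClos S '' 𝒰 }, alphaMap S Φ := by
  classical
  refine Set.Subset.antisymm ?_ ?_
  · rintro m ⟨φ, hφ, h1, rfl⟩
    have hex : ∀ x, ∃ U : Set X, x ∈ φ.support → U ∈ 𝒰 ∧ x ∈ U := by
      intro x
      by_cases hx : x ∈ φ.support
      · obtain ⟨U, hU⟩ := hφ hx
        exact ⟨U, fun _ => hU⟩
      · exact ⟨∅, fun h => absurd h hx⟩
    choose V hV using hex
    let B : X → Set X := fun x => convClos S (V x)
    let Φ : Set X →₀ S := Finsupp.mapDomain B φ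
    have hΦ : ∀ A, Φ A = ∑ x ∈ φ.support with B x = A, φ x := by
      intro A
      simp [Φ, Finsupp.mapDomain, Finsupp.sum, Finsupp.finsetSum_apply, Finsupp.single_apply,
        Finset.sum_filter]
    have hsupp : Φ.support ⊆ φ.support.image B := Finsupp.mapDomain_support
    have hne : ∀ x ∈ φ.support, Φ (B x) ≠ 0 := by
      intro x hx h0
      rw [hΦ] at h0
      exact Finsupp.mem_support_iff.mp hx
        (eq_zero_of_sum_eq_zero hpos h0 (Finset.mem_filter.mpr ⟨hx, rfl⟩))
    have hmem : ∀ x ∈ φ.support, B x ∈ Φ.support :=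
      fun x hx => Finsupp.mem_support_iff.mpr (hne x hx)
    let u : Set X → X := fun A => ∑ x ∈ φ.support with B x = A, ((Φ A)⁻¹ * φ x) • x
    refine Set.mem_biUnion (x := Φ) ⟨?_, ?_⟩ ⟨Finsupp.mapDomain u Φ, ⟨u, ?_, rfl⟩, ?_⟩
    · rw [← h1]
      exact Finsupp.sum_mapDomain_index (fun _ => rfl) fun _ _ _ => rfl
    · intro A hA
      obtain ⟨x, hx, rfl⟩ := Finset.mem_image.mp (hsupp hA)
      exact ⟨V x, (hV x hx).1, rfl⟩
    · intro A hA
      obtain ⟨x₀, -, rfl⟩ := Finset.mem_image.mp (hsupp hA)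
      refine sum_smul_mem_convClos _ _ (fun x => x) ?_ fun x hx => ?_
      · rw [← Finset.mul_sum, ← hΦ]
        exact inv_mul_cancel₀ (Finsupp.mem_support_iff.mp hA)
      · obtain ⟨hx, hxB⟩ := Finset.mem_filter.mp hx
        change x ∈ B x₀
        rw [← hxB]
        exact subset_convClos S _ (hV x hx).2
    · rw [structMap_mapDomain, structMap, Finsupp.sum, Finsupp.sum,
        ← Finset.sum_fiberwise_of_maps_to hmem]
      refine Finset.sum_congr rfl fun A hA => ?_
      rw [Finset.smul_sum]
      refine Finset.sum_congr rfl fun x _ => ?_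
      rw [smul_smul, mul_inv_cancel_left₀ (Finsupp.mem_support_iff.mp hA)]
  · refine Set.iUnion₂_subset ?_
    rintro Φ ⟨h1, hΦ⟩ _ ⟨_, ⟨u, hu, rfl⟩, rfl⟩
    rw [structMap_mapDomain]
    refine sum_smul_mem_convClos Φ.support Φ u h1 fun A hA => ?_
    obtain ⟨U, hU, rfl⟩ := hΦ hA
    exact convClos_mono S (Set.subset_sUnion_of_mem hU) (hu _ hA)
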